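/- Let (W, S) be a Coxeter system, let P = u⟨S'⟩u⁻¹ be a parabolic subgroup (u ∈ W, S' ⊆ S), and let w ∈ P. Then every reduced reflection factorization of w consists of reflections lying in P: for every (t₁, …, t_m) ∈ Red_T(w), each tᵢ belongs to T ∩ P. Moreover, the minimal length of a factorization of w into elements of T equals the minimal length of a factorization of w into elements of T ∩ P, so Red_T(w) = Red_{T ∩ P}(w). -/

import Mathlib

/-- The reflection length `ℓ_T w` of `w` in a Coxeter system: the least `k` such that
`w` is a product of `k` reflections. -/
noncomputable def reflLen {B W : Type*} [Group W] {M : CoxeterMatrix B}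
    (cs : CoxeterSystem M W) (w : W) : ℕ :=
  sInf {k | ∃ l : List W, l.length = k ∧ (∀ t ∈ l, cs.IsReflection t) ∧ l.prod = w}

/-- `Red_T w`: the set of reduced reflection factorizations of `w`, i.e. tuples of
reflections of length `ℓ_T w` with product `w`. -/
noncomputable def RedT {B W : Type*} [Group W] {M : CoxeterMatrix B}
    (cs : CoxeterSystem M W) (w : W) : Set (List W) :=
  {l | l.length = reflLen cs w ∧ (∀ t ∈ l, cs.IsReflection t) ∧ l.prod = w}

/-- The least `k` such that `w` is a product of `k` reflections all lying in the
set `A`. -/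
noncomputable def reflLenIn {B W : Type*} [Group W] {M : CoxeterMatrix B}
    (cs : CoxeterSystem M W) (A : Set W) (w : W) : ℕ :=
  sInf {k | ∃ l : List W,
    l.length = k ∧ (∀ t ∈ l, cs.IsReflection t ∧ t ∈ A) ∧ l.prod = w}

/-- `Red_{T ∩ A} w`: reduced factorizations of `w` into reflections lying in `A`. -/
noncomputable def RedTIn {B W : Type*} [Group W] {M : CoxeterMatrix B}
    (cs : CoxeterSystem M W) (A : Set W) (w : W) : Set (List W) :=
  {l | l.length = reflLenIn cs A w ∧
    (∀ t ∈ l, cs.IsReflection t ∧ t ∈ A) ∧ l.prod = w}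

/-- A parabolic subgroup of a Coxeter system: a conjugate `u ⟨S'⟩ u⁻¹` of the subgroup
generated by a subset `S'` of the simple reflections. -/
def IsParabolic {B W : Type*} [Group W] {M : CoxeterMatrix B}
    (cs : CoxeterSystem M W) (P : Subgroup W) : Prop :=
  ∃ (u : W) (S' : Set B),
    P = (Subgroup.closure (cs.simple '' S')).map (MulAut.conj u).toMonoidHom

namespace CoxeterSystem

variable {B W : Type*} [Group W] {M : CoxeterMatrix B} (cs : CoxeterSystem M W)

open Classical in
/-- The action of a simple reflection on pairs `(t, ε)`: it conjugates `t` and flips the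
sign `ε` exactly when `t` is that simple reflection. -/
noncomputable def signedConj (i : B) : Function.End (W × ZMod 2) := fun p ↦
  (cs.simple i * p.1 * cs.simple i, p.2 + if p.1 = cs.simple i then 1 else 0)

open Classical in
theorem signedConj_mul_pow_apply (i j : B) (k : ℕ) (t : W) (ε : ZMod 2) :
    ((cs.signedConj i * cs.signedConj j) ^ k) (t, ε) =
      ((cs.simple i * cs.simple j) ^ k * t * ((cs.simple i * cs.simple j) ^ k)⁻¹,
        ε + ∑ a ∈ Finset.range (2 * k),
          if t = cs.simple j * (cs.simple i * cs.simple j) ^ a then 1 else 0) := by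
  induction k with
  | zero => simp; rfl
  | succ k ih =>
    have step : ((cs.signedConj i * cs.signedConj j) ^ (k + 1)) (t, ε) =
        cs.signedConj i (cs.signedConj j (((cs.signedConj i * cs.signedConj j) ^ k) (t, ε))) := by
      rw [pow_succ']; rfl
    rw [step, ih]
    set p := cs.simple i * cs.simple j with hp
    have hconj : ∀ n : ℕ, cs.simple j * p ^ n = (p ^ n)⁻¹ * cs.simple j := by
      intro n
      have h1 : cs.simple j * p * (cs.simple j)⁻¹ = p⁻¹ := by simp [hp, mul_assoc]
      rw [← inv_pow, ← h1, conj_pow]; simp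
    have h1 : (p ^ k * t * (p ^ k)⁻¹ = cs.simple j) ↔ t = cs.simple j * p ^ (2 * k) := by
      rw [two_mul, pow_add, ← mul_assoc, hconj k, mul_inv_eq_iff_eq_mul, mul_assoc,
        eq_inv_mul_iff_mul_eq]
    have h2 : (cs.simple j * (p ^ k * t * (p ^ k)⁻¹) * cs.simple j = cs.simple i) ↔
        t = cs.simple j * p ^ (2 * k + 1) := by
      have e : cs.simple j * p ^ (2 * k + 1) =
          (p ^ k)⁻¹ * (cs.simple j * cs.simple i * cs.simple j) * p ^ k := by
        rw [show 2 * k + 1 = k + 1 + k by ring, pow_add, pow_succ, ← mul_assoc, ← mul_assoc,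
          hconj k, hp]
        simp only [mul_assoc]
      rw [e]
      constructor
      · intro h
        rw [← h]
        simp [mul_assoc]
      · rintro rfl
        simp [mul_assoc]
    simp only [signedConj, h1, h2]
    rw [show 2 * (k + 1) = 2 * k + 1 + 1 by ring, Finset.sum_range_succ, Finset.sum_range_succ]
    refine Prod.ext ?_ ?_
    · simp [pow_succ', hp, mul_assoc]
    · simp [add_assoc]

theorem isLiftable_signedConj : M.IsLiftable cs.signedConj := by
  classical
  intro i j
  funext ⟨t, ε⟩
  rw [signedConj_mul_pow_apply, two_mul, Finset.sum_range_add]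
  simp only [pow_add, cs.simple_mul_simple_pow, one_mul, CharTwo.add_self_eq_zero]
  simp only [inv_one, mul_one, add_zero]
  rfl

/-- The action of a Coxeter group on `W × ZMod 2` extending `signedConj`. -/
noncomputable def signedConjHom : W →* Function.End (W × ZMod 2) :=
  cs.lift ⟨cs.signedConj, cs.isLiftable_signedConj⟩

open Classical in
theorem signedConjHom_wordProd_apply (ω : List B) (t : W) (ε : ZMod 2) :
    cs.signedConjHom (cs.wordProd ω) (t, ε) =
      (cs.wordProd ω * t * (cs.wordProd ω)⁻¹, ε + (cs.rightInvSeq ω).count t) := by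
  induction ω with
  | nil => simp; rfl
  | cons i ω ih =>
    have step : cs.signedConjHom (cs.wordProd (i :: ω)) (t, ε) =
        cs.signedConj i (cs.signedConjHom (cs.wordProd ω) (t, ε)) := by
      rw [wordProd_cons, map_mul]
      have : cs.signedConjHom (cs.simple i) = cs.signedConj i :=
        cs.lift_apply_simple cs.isLiftable_signedConj i
      rw [this]; rfl
    rw [step, ih]
    have h : (cs.wordProd ω * t * (cs.wordProd ω)⁻¹ = cs.simple i) ↔
        (cs.wordProd ω)⁻¹ * cs.simple i * cs.wordProd ω = t := by
      constructor
      · intro h; rw [← h]; simp [mul_assoc]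
      · rintro rfl; simp [mul_assoc]
    simp only [signedConj, rightInvSeq, List.count_cons, h, beq_iff_eq]
    refine Prod.ext ?_ ?_
    · simp [wordProd_cons, mul_assoc]
    · by_cases h' : (cs.wordProd ω)⁻¹ * cs.simple i * cs.wordProd ω = t <;> simp [h', add_assoc]

/-- The parity of the number of occurrences of `t` in the right inversion sequence of any
word for `w`. -/
noncomputable def invParity (w t : W) : ZMod 2 := (cs.signedConjHom w (t, 0)).2

open Classical in
theorem invParity_wordProd (ω : List B) (t : W) :
    cs.invParity (cs.wordProd ω) t = (cs.rightInvSeq ω).count t := by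
  simp [invParity, signedConjHom_wordProd_apply]

theorem signedConjHom_apply (w t : W) (ε : ZMod 2) :
    cs.signedConjHom w (t, ε) = (w * t * w⁻¹, ε + cs.invParity w t) := by
  obtain ⟨ω, rfl⟩ := cs.wordProd_surjective w
  rw [invParity_wordProd, signedConjHom_wordProd_apply]

theorem invParity_mul (v w t : W) :
    cs.invParity (v * w) t = cs.invParity w t + cs.invParity v (w * t * w⁻¹) := by
  have : cs.signedConjHom (v * w) (t, 0) = cs.signedConjHom v (cs.signedConjHom w (t, 0)) := by
    rw [map_mul]; rfl
  rw [invParity, this, signedConjHom_apply, signedConjHom_apply, zero_add]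

theorem invParity_one (t : W) : cs.invParity 1 t = 0 := by
  simpa using cs.invParity_wordProd [] t

theorem IsReflection.invParity_self {cs : CoxeterSystem M W} {t : W} (ht : cs.IsReflection t) :
    cs.invParity t t = 1 := by
  obtain ⟨u, i, rfl⟩ := ht
  have hs : cs.invParity (cs.simple i) (cs.simple i) = 1 := by
    simpa using cs.invParity_wordProd [i] (cs.simple i)
  have h1 := cs.invParity_mul u u⁻¹ (u * cs.simple i * u⁻¹)
  rw [mul_inv_cancel, invParity_one] at h1
  rw [invParity_mul, invParity_mul]
  simp only [mul_assoc, inv_inv, inv_mul_cancel_left, inv_mul_cancel, mul_one,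
    one_mul, simple_mul_simple_self, inv_simple] at h1 ⊢
  rw [hs, add_left_comm, ← h1, add_zero]

theorem length_wordProd_mul_lt_of_mem_rightInvSeq {ω : List B} {t : W}
    (ht : t ∈ cs.rightInvSeq ω) : cs.length (cs.wordProd ω * t) < ω.length := by
  induction ω with
  | nil => simp at ht
  | cons i ω ih =>
    rw [rightInvSeq, List.mem_cons] at ht
    rw [wordProd_cons, List.length_cons]
    rcases ht with rfl | ht
    · have : cs.simple i * cs.wordProd ω * ((cs.wordProd ω)⁻¹ * cs.simple i * cs.wordProd ω) =
          cs.wordProd ω := by simp [mul_assoc]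
      rw [this]
      exact Nat.lt_succ_of_le (cs.length_wordProd_le ω)
    · have h1 := cs.length_mul_le (cs.simple i) (cs.wordProd ω * t)
      rw [length_simple, ← mul_assoc] at h1
      have := ih ht
      omega

/-- The **strong exchange property**: a right inversion of `π ω` occurs in the right
inversion sequence of `ω`, whether or not `ω` is reduced. -/
theorem IsRightInversion.mem_rightInvSeq {cs : CoxeterSystem M W} {ω : List B} {t : W}
    (h : cs.IsRightInversion (cs.wordProd ω) t) : t ∈ cs.rightInvSeq ω := by
  classical
  obtain ⟨ht, hlt⟩ := h
  by_contra hmem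
  have h0 : cs.invParity (cs.wordProd ω) t = 0 := by
    rw [invParity_wordProd, List.count_eq_zero_of_not_mem hmem, Nat.cast_zero]
  have h1 : cs.invParity (cs.wordProd ω * t) t = 1 := by
    rw [invParity_mul, ht.invParity_self, mul_inv_cancel_right, h0, add_zero]
  obtain ⟨α, hα, hαw⟩ := cs.exists_isReduced (cs.wordProd ω * t)
  rw [hαw, invParity_wordProd] at h1
  have hα_mem : t ∈ cs.rightInvSeq α := by
    by_contra hn
    rw [List.count_eq_zero_of_not_mem hn] at h1
    simp at h1
  have := cs.length_wordProd_mul_lt_of_mem_rightInvSeq hα_mem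
  rw [← hα.eq, ← hαw, mul_assoc, ht.mul_self, mul_one] at this
  omega

/-- Deleting from a word the letters that correspond to two distinct entries of its right
inversion sequence. -/
theorem length_wordProd_mul_mul_add_two_le {ω : List B} {a b : W}
    (ha : a ∈ cs.rightInvSeq ω) (hb : b ∈ cs.rightInvSeq ω) (hab : a ≠ b) :
    cs.length (cs.wordProd ω * a * b) + 2 ≤ ω.length ∨
      cs.length (cs.wordProd ω * b * a) + 2 ≤ ω.length := by
  induction ω with
  | nil => simp at ha
  | cons i ω ih =>
    have key : ∀ c : W, cs.simple i * cs.wordProd ω *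
        ((cs.wordProd ω)⁻¹ * cs.simple i * cs.wordProd ω) * c = cs.wordProd ω * c := by
      intro c; simp [mul_assoc]
    rw [rightInvSeq, List.mem_cons] at ha hb
    rw [wordProd_cons, List.length_cons]
    rcases ha with rfl | ha <;> rcases hb with rfl | hb
    · exact absurd rfl hab
    · left
      rw [key]
      have := cs.length_wordProd_mul_lt_of_mem_rightInvSeq hb
      omega
    · right
      rw [key]
      have := cs.length_wordProd_mul_lt_of_mem_rightInvSeq ha
      omega
    · have h1 := cs.length_mul_le (cs.simple i) (cs.wordProd ω * a * b)
      have h2 := cs.length_mul_le (cs.simple i) (cs.wordProd ω * b * a)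
      simp only [length_simple, ← mul_assoc] at h1 h2
      have := ih ha hb
      omega

theorem length_mul_mul_lt_or_of_isRightInversion {x a b : W} (ha : cs.IsRightInversion x a)
    (hb : cs.IsRightInversion x b) (hab : a ≠ b) :
    cs.length (x * a * b) < cs.length x ∨ cs.length (x * b * a) < cs.length x := by
  obtain ⟨ω, hω, rfl⟩ := cs.exists_isReduced x
  have := cs.length_wordProd_mul_mul_add_two_le ha.mem_rightInvSeq hb.mem_rightInvSeq hab
  rw [hω.eq]
  omega

theorem exists_word_of_mem_closure_simple {I : Set B} {w : W}
    (hw : w ∈ Subgroup.closure (cs.simple '' I)) :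
    ∃ ω : List B, (∀ i ∈ ω, i ∈ I) ∧ cs.wordProd ω = w := by
  induction hw using Subgroup.closure_induction with
  | mem x hx =>
    obtain ⟨i, hi, rfl⟩ := hx
    exact ⟨[i], by simpa using hi, by simp⟩
  | one => exact ⟨[], by simp, by simp⟩
  | mul x y _ _ hx hy =>
    obtain ⟨α, hα, rfl⟩ := hx
    obtain ⟨β, hβ, rfl⟩ := hy
    refine ⟨α ++ β, fun i hi ↦ ?_, cs.wordProd_append α β⟩
    exact (List.mem_append.1 hi).elim (hα i) (hβ i)
  | inv x _ hx =>
    obtain ⟨α, hα, rfl⟩ := hx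
    exact ⟨α.reverse, by simpa using hα, cs.wordProd_reverse α⟩

theorem wordProd_mem_closure_simple {I : Set B} {ω : List B} (hω : ∀ i ∈ ω, i ∈ I) :
    cs.wordProd ω ∈ Subgroup.closure (cs.simple '' I) := by
  refine Subgroup.list_prod_mem _ fun x hx ↦ ?_
  obtain ⟨i, hi, rfl⟩ := List.mem_map.1 hx
  exact Subgroup.subset_closure ⟨i, hω i hi, rfl⟩

theorem mem_closure_simple_of_mem_rightInvSeq {I : Set B} {ω : List B} (hω : ∀ i ∈ ω, i ∈ I)
    {t : W} (ht : t ∈ cs.rightInvSeq ω) : t ∈ Subgroup.closure (cs.simple '' I) := by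
  induction ω with
  | nil => simp at ht
  | cons i ω ih =>
    rw [List.forall_mem_cons] at hω
    rw [rightInvSeq, List.mem_cons] at ht
    rcases ht with rfl | ht
    · have h := cs.wordProd_mem_closure_simple hω.2
      exact mul_mem (mul_mem (inv_mem h) (Subgroup.subset_closure ⟨i, hω.1, rfl⟩)) h
    · exact ih hω.2 ht

theorem IsRightInversion.mem_closure_simple {cs : CoxeterSystem M W} {I : Set B} {w t : W}
    (ht : cs.IsRightInversion w t) (hw : w ∈ Subgroup.closure (cs.simple '' I)) :
    t ∈ Subgroup.closure (cs.simple '' I) := by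
  obtain ⟨ω, hω, rfl⟩ := cs.exists_word_of_mem_closure_simple hw
  exact cs.mem_closure_simple_of_mem_rightInvSeq hω ht.mem_rightInvSeq

/-- A path in the Bruhat graph without peaks whose first step goes up stays inside any
standard parabolic subgroup that contains its endpoint. -/
theorem forall_mem_closure_simple_of_no_peak {I : Set B} (l : List W) (x : W)
    (hl : ∀ t ∈ l, cs.IsReflection t)
    (hup : ∀ a l', l = a :: l' → cs.length x < cs.length (x * a))
    (hpeak : ∀ l₁ a b l₂, l = l₁ ++ a :: b :: l₂ →
      cs.length (x * l₁.prod) < cs.length (x * l₁.prod * a) →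
      ¬ cs.length (x * l₁.prod * a * b) < cs.length (x * l₁.prod * a))
    (hx : x * l.prod ∈ Subgroup.closure (cs.simple '' I)) :
    x ∈ Subgroup.closure (cs.simple '' I) ∧ ∀ t ∈ l, t ∈ Subgroup.closure (cs.simple '' I) := by
  induction l generalizing x with
  | nil => simpa using hx
  | cons a l ih =>
    rw [List.forall_mem_cons] at hl
    have hxa := hup a l rfl
    obtain ⟨h1, h2⟩ := ih (x * a) hl.2
      (by
        rintro b l' rfl
        have := hpeak [] a b l' rfl (by simpa using hxa)
        have hne := (hl.2 b (by simp)).length_mul_left_ne (x * a)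
        simp only [List.prod_nil, mul_one] at this
        omega)
      (by
        rintro l₁ b c l₂ rfl
        have := hpeak (a :: l₁) b c l₂ rfl
        simpa [mul_assoc] using this)
      (by simpa [mul_assoc] using hx)
    have ha : a ∈ Subgroup.closure (cs.simple '' I) := by
      refine IsRightInversion.mem_closure_simple ⟨hl.1, ?_⟩ h1
      rwa [mul_assoc, hl.1.mul_self, mul_one]
    refine ⟨by simpa using mul_mem h1 (inv_mem ha), ?_⟩
    rw [List.forall_mem_cons]
    exact ⟨ha, h2⟩

/-- The sum of the lengths of the vertices, other than `x`, of the path that starts at `x`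
and has steps `l`. -/
noncomputable def pathWeight : W → List W → ℕ
  | _, [] => 0
  | x, a :: l => cs.length (x * a) + pathWeight (x * a) l

theorem pathWeight_append (x : W) (l₁ l₂ : List W) :
    cs.pathWeight x (l₁ ++ l₂) = cs.pathWeight x l₁ + cs.pathWeight (x * l₁.prod) l₂ := by
  induction l₁ generalizing x with
  | nil => simp [pathWeight]
  | cons a l ih => simp [pathWeight, ih, mul_assoc, add_assoc]

theorem forall_mem_closure_simple_of_minimal {I : Set B} (l : List W)
    (hl : ∀ t ∈ l, cs.IsReflection t)
    (hmin : ∀ l' : List W, (∀ t ∈ l', cs.IsReflection t) → l'.prod = l.prod →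
      l.length ≤ l'.length)
    (hw : l.prod ∈ Subgroup.closure (cs.simple '' I)) :
    ∀ t ∈ l, t ∈ Subgroup.closure (cs.simple '' I) := by
  induction hN : cs.pathWeight 1 l using Nat.strong_induction_on generalizing l with
  | _ N ih =>
  subst hN
  by_cases hpeak : ∃ l₁ a b l₂, l = l₁ ++ a :: b :: l₂ ∧
      cs.length (l₁.prod) < cs.length (l₁.prod * a) ∧
      cs.length (l₁.prod * a * b) < cs.length (l₁.prod * a)
  · obtain ⟨l₁, a, b, l₂, rfl, hup, hdown⟩ := hpeak
    have ha : cs.IsReflection a := hl a (by simp)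
    have hb : cs.IsReflection b := hl b (by simp)
    have haa := ha.mul_self
    have hbb := hb.mul_self
    have hab : a ≠ b := by
      rintro rfl
      have := hmin (l₁ ++ l₂) (fun t ht ↦ hl t (by simp at ht ⊢; tauto))
        (by simp [← mul_assoc a a, haa])
      simp at this
    have replace : ∀ a' b' : W, cs.IsReflection a' → cs.IsReflection b' → a' * b' = a * b →
        cs.length (l₁.prod * a') < cs.length (l₁.prod * a) →
        a' ∈ Subgroup.closure (cs.simple '' I) ∧ b' ∈ Subgroup.closure (cs.simple '' I) ∧
        (∀ t ∈ l₁, t ∈ Subgroup.closure (cs.simple '' I)) ∧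
        ∀ t ∈ l₂, t ∈ Subgroup.closure (cs.simple '' I) := by
      intro a' b' ha' hb' hprod hlt
      have hp : (l₁ ++ a' :: b' :: l₂).prod = (l₁ ++ a :: b :: l₂).prod := by
        simp only [List.prod_append, List.prod_cons]
        rw [← mul_assoc a' b', hprod, mul_assoc a b]
      have := ih (cs.pathWeight 1 (l₁ ++ a' :: b' :: l₂))
        (by
          simp only [pathWeight_append, pathWeight, one_mul]
          rw [mul_assoc _ a' b', hprod, ← mul_assoc _ a b]
          omega)
        (l₁ ++ a' :: b' :: l₂)
        (by
          intro t ht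
          simp only [List.mem_append, List.mem_cons] at ht hl
          rcases ht with ht | rfl | rfl | ht
          · exact hl t (.inl ht)
          · exact ha'
          · exact hb'
          · exact hl t (.inr (.inr (.inr ht))))
        (by
          intro l' h1 h2
          simpa using hmin l' h1 (h2.trans hp))
        (hp ▸ hw) rfl
      exact ⟨this a' (by simp), this b' (by simp), fun t ht ↦ this t (by simp [ht]),
        fun t ht ↦ this t (by simp [ht])⟩
    have hmem : (a ∈ Subgroup.closure (cs.simple '' I) ∧
        b ∈ Subgroup.closure (cs.simple '' I)) ∧
        (∀ t ∈ l₁, t ∈ Subgroup.closure (cs.simple '' I)) ∧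
        ∀ t ∈ l₂, t ∈ Subgroup.closure (cs.simple '' I) := by
      have hxa : cs.IsRightInversion (l₁.prod * a) a :=
        ⟨ha, by rwa [mul_assoc, haa, mul_one]⟩
      rcases cs.length_mul_mul_lt_or_of_isRightInversion hxa ⟨hb, hdown⟩ hab with h | h
      · obtain ⟨h1, h2, h3, h4⟩ := replace b (b⁻¹ * a * b)
          hb (by simpa using ha.conj b⁻¹) (by simp [mul_assoc])
          (by rwa [mul_assoc _ a a, haa, mul_one] at h)
        refine ⟨⟨?_, h1⟩, h3, h4⟩
        simpa [mul_assoc] using mul_mem (mul_mem h1 h2) (inv_mem h1)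
      · obtain ⟨h1, h2, h3, h4⟩ := replace (a * b * a⁻¹) a
          (hb.conj a) ha (by simp)
          (by rwa [ha.inv, ← mul_assoc, ← mul_assoc])
        refine ⟨⟨h2, ?_⟩, h3, h4⟩
        simpa [mul_assoc] using mul_mem (mul_mem (inv_mem h2) h1) h2
    obtain ⟨⟨h1, h2⟩, h3, h4⟩ := hmem
    intro t ht
    simp only [List.mem_append, List.mem_cons] at ht
    rcases ht with ht | rfl | rfl | ht
    exacts [h3 t ht, h1, h2, h4 t ht]
  · refine (cs.forall_mem_closure_simple_of_no_peak l 1 hl ?_ ?_ (by simpa using hw)).2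
    · rintro a l' rfl
      have := (hl a (by simp)).odd_length.pos
      simpa using this
    · intro l₁ a b l₂ h h1 h2
      rw [one_mul] at h1 h2
      exact hpeak ⟨l₁, a, b, l₂, h, h1, h2⟩

theorem exists_reflection_list_prod_eq (w : W) :
    ∃ l : List W, (∀ t ∈ l, cs.IsReflection t) ∧ l.prod = w := by
  obtain ⟨ω, rfl⟩ := cs.wordProd_surjective w
  refine ⟨ω.map cs.simple, fun t ht ↦ ?_, rfl⟩
  obtain ⟨i, -, rfl⟩ := List.mem_map.1 ht
  exact cs.isReflection_simple i

end CoxeterSystem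

section

variable {B W : Type*} [Group W] {M : CoxeterMatrix B} (cs : CoxeterSystem M W)

theorem reflLen_prod_le {l : List W} (hl : ∀ t ∈ l, cs.IsReflection t) :
    reflLen cs l.prod ≤ l.length :=
  Nat.sInf_le ⟨l, rfl, hl, rfl⟩

theorem reflLenIn_prod_le {A : Set W} {l : List W} (hl : ∀ t ∈ l, cs.IsReflection t ∧ t ∈ A) :
    reflLenIn cs A l.prod ≤ l.length :=
  Nat.sInf_le ⟨l, rfl, hl, rfl⟩

theorem RedT_nonempty (w : W) : (RedT cs w).Nonempty := by
  obtain ⟨l, hl, hw⟩ := cs.exists_reflection_list_prod_eq w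
  exact Nat.sInf_mem (s := {k | ∃ l : List W,
    l.length = k ∧ (∀ t ∈ l, cs.IsReflection t) ∧ l.prod = w}) ⟨_, l, rfl, hl, hw⟩

theorem RedTIn_nonempty {A : Set W} {l : List W} (hl : ∀ t ∈ l, cs.IsReflection t ∧ t ∈ A) :
    (RedTIn cs A l.prod).Nonempty :=
  Nat.sInf_mem (s := {k | ∃ l' : List W,
    l'.length = k ∧ (∀ t ∈ l', cs.IsReflection t ∧ t ∈ A) ∧ l'.prod = l.prod})
    ⟨_, l, rfl, hl, rfl⟩

theorem IsParabolic.mem_of_mem_RedT {cs : CoxeterSystem M W} {P : Subgroup W}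
    (hP : IsParabolic cs P) {l : List W} {w : W} (hw : w ∈ P) (hl : l ∈ RedT cs w) :
    ∀ t ∈ l, t ∈ P := by
  obtain ⟨u, I, rfl⟩ := hP
  obtain ⟨hlen, hrefl, rfl⟩ := hl
  have hmem : ∀ t : W, t ∈ (Subgroup.closure (cs.simple '' I)).map (MulAut.conj u).toMonoidHom ↔
      MulAut.conj u⁻¹ t ∈ Subgroup.closure (cs.simple '' I) := by
    intro t
    rw [Subgroup.mem_map_equiv, ← MulAut.inv_def, ← map_inv]
  have hrefl_map : ∀ (v : W) (l : List W), (∀ t ∈ l, cs.IsReflection t) →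
      ∀ t ∈ l.map (MulAut.conj v), cs.IsReflection t := by
    intro v l h t ht
    obtain ⟨r, hr, rfl⟩ := List.mem_map.1 ht
    exact (h r hr).conj v
  have := cs.forall_mem_closure_simple_of_minimal (I := I) (l.map (MulAut.conj u⁻¹))
    (hrefl_map _ _ hrefl)
    (by
      intro l' h1 h2
      rw [← map_list_prod] at h2
      have h3 := reflLen_prod_le cs (hrefl_map u l' h1)
      rw [← map_list_prod, h2] at h3
      rw [List.length_map, hlen]
      simpa [mul_assoc] using h3)
    (by rw [← map_list_prod]; exact (hmem _).1 hw)
  exact fun t ht ↦ (hmem t).2 (this _ (List.mem_map_of_mem ht))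

end

/-- Let `P` be a parabolic subgroup of a Coxeter system `(W, S)` and `w ∈ P`.  Then every
reduced reflection factorization of `w` consists of reflections lying in `P`; moreover
the minimal length of a factorization of `w` into reflections equals the minimal length
of a factorization into reflections lying in `P`, and `Red_T w = Red_{T ∩ P} w`. -/
theorem redT_subset_parabolic
    {B W : Type*} [Group W] {M : CoxeterMatrix B} (cs : CoxeterSystem M W)
    (P : Subgroup W) (hP : IsParabolic cs P) (w : W) (hw : w ∈ P) :
    (∀ l ∈ RedT cs w, ∀ t ∈ l, t ∈ P) ∧
    reflLen cs w = reflLenIn cs (P : Set W) w ∧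
    RedT cs w = RedTIn cs (P : Set W) w := by
  have hmem : ∀ l ∈ RedT cs w, ∀ t ∈ l, t ∈ P := fun l hl ↦ hP.mem_of_mem_RedT hw hl
  have hlen : reflLen cs w = reflLenIn cs (P : Set W) w := by
    obtain ⟨l, hl⟩ := RedT_nonempty cs w
    have hlP : ∀ t ∈ l, cs.IsReflection t ∧ t ∈ (P : Set W) :=
      fun t ht ↦ ⟨hl.2.1 t ht, hmem l hl t ht⟩
    obtain ⟨l', hl'⟩ := RedTIn_nonempty cs hlP
    have h1 := reflLenIn_prod_le cs hlP
    have h2 := reflLen_prod_le cs fun t ht ↦ (hl'.2.1 t ht).1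
    rw [hl'.2.2, hl'.1] at h2
    rw [hl.1] at h1
    rw [hl.2.2] at h1 h2
    exact le_antisymm h2 h1
  refine ⟨hmem, hlen, Set.ext fun l ↦ ⟨fun hl ↦ ?_, fun hl ↦ ?_⟩⟩
  · exact ⟨hlen ▸ hl.1, fun t ht ↦ ⟨hl.2.1 t ht, hmem l hl t ht⟩, hl.2.2⟩
  · exact ⟨hlen ▸ hl.1, fun t ht ↦ (hl.2.1 t ht).1, hl.2.2⟩
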